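/- (Replay detection.) Let h : β → α be an injective leaf-hash function and H : α → α → α a pairwise injective combiner. Let L be a nonempty log with indices i ≠ j such that L[i] ≠ L[j], and let L' be obtained from L by replacing the entry at position i with the (valid but replayed) entry L[j]. Then root(L'.map h) ≠ root(L.map h), so the replay is detected by verification against the anchored root. -/

import Mathlib

/-- Side of a sibling hash in an inclusion proof. -/
inductive Side
  | left
  | right
deriving DecidableEq, Repr

/-- One Merkle level step: combine consecutive pairs with `H`,
promoting an unpaired final element unchanged. -/
def levelStep {α : Type*} (H : α → α → α) : List α → List α
  | a :: b :: rest => H a b :: levelStep H rest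
  | l => l

theorem levelStep_length {α : Type*} (H : α → α → α) :
    (l : List α) → (levelStep H l).length = (l.length + 1) / 2
  | [] => by simp [levelStep]
  | [_] => by simp [levelStep]
  | a :: b :: rest => by
      simp only [levelStep, List.length_cons, levelStep_length H rest]
      omega

/-- The Merkle root of a list of leaf hashes (`none` on the empty list),
obtained by iterating the level step until a single hash remains. -/
def merkleRoot? {α : Type*} (H : α → α → α) : List α → Option α
  | [] => none
  | [a] => some a
  | a :: b :: rest => merkleRoot? H (levelStep H (a :: b :: rest))
termination_by l => l.length
decreasing_by
  simp only [levelStep_length, List.length_cons]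
  omega

theorem levelStep_inj_aux {α : Type*} (H : α → α → α)
    (hH : ∀ a b c d : α, H a b = H c d → a = c ∧ b = d) :
    (l m : List α) → l.length = m.length → levelStep H l = levelStep H m → l = m
  | [], m, hl, _ => (List.length_eq_zero_iff.mp hl.symm).symm
  | [_], [], hl, _ => by simp at hl
  | [_], [_], _, h => by simpa [levelStep] using h
  | [_], _ :: _ :: _, hl, _ => by simp at hl
  | _ :: _ :: _, [], hl, _ => by simp at hl
  | _ :: _ :: _, [_], hl, _ => by simp at hl
  | a :: b :: r, c :: d :: t, hl, h => by
      simp only [levelStep, List.cons.injEq] at h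
      obtain ⟨h1, h2⟩ := hH _ _ _ _ h.1
      have h3 := levelStep_inj_aux H hH r t (by simpa using hl) h.2
      rw [h1, h2, h3]

theorem merkleRoot_inj_aux {α : Type*} (H : α → α → α)
    (hH : ∀ a b c d : α, H a b = H c d → a = c ∧ b = d) (n : ℕ) :
    ∀ l m : List α, l.length = n → m.length = n →
      merkleRoot? H l = merkleRoot? H m → l = m := by
  induction n using Nat.strong_induction_on with
  | _ n ih =>
    intro l m hl hm h
    match l, m, hl, hm, h with
    | [], m, hl, hm, _ =>
      exact (List.length_eq_zero_iff.mp (hm.trans hl.symm)).symm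
    | [_], [], hl, hm, _ => simp at hl hm; omega
    | [_], [_], _, _, h => simpa [merkleRoot?] using h
    | [_], _ :: _ :: _, hl, hm, _ => simp at hl hm; omega
    | _ :: _ :: _, [], hl, hm, _ => simp at hl hm; omega
    | _ :: _ :: _, [_], hl, hm, _ => simp at hl hm; omega
    | a :: b :: r, c :: d :: t, hl, hm, h =>
      rw [merkleRoot?, merkleRoot?] at h
      have hn : 2 ≤ n := by simp at hl; omega
      refine levelStep_inj_aux H hH _ _ (hl.trans hm.symm) ?_
      exact ih ((n + 1) / 2) (by omega) _ _ (by rw [levelStep_length, hl])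
        (by rw [levelStep_length, hm]) h

/-- **Replay detection.** With an injective leaf-hash function `hf` and a
pairwise injective combiner `H`, replaying a valid entry `L[j]` at a different
position `i` (where `L[i] ≠ L[j]`) changes the Merkle root, so the replay is
detected by verification against the anchored root. -/
theorem merkleRoot_ne_of_replay {α β : Type*} (hf : β → α)
    (hfinj : Function.Injective hf) (H : α → α → α)
    (hH : ∀ a b c d : α, H a b = H c d → a = c ∧ b = d)
    (L : List β) (hne : L ≠ []) (i j : ℕ) (hi : i < L.length)
    (hj : j < L.length) (hij : i ≠ j) (hdiff : L[i] ≠ L[j]) :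
    merkleRoot? H ((L.set i L[j]).map hf) ≠ merkleRoot? H (L.map hf) := by
  intro h
  have h1 := merkleRoot_inj_aux H hH L.length _ _ (by simp) (by simp) h
  have h2 := List.map_injective_iff.mpr hfinj h1
  have h3 : (L.set i L[j])[i]? = L[i]? := by rw [h2]
  rw [List.getElem?_set_self hi, List.getElem?_eq_getElem hi] at h3
  exact hdiff (Option.some.inj h3).symm
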